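/- arXiv:1707.04769 — 2 statements merged into one kernel-verified Lean document; each statement's English description precedes it below -/
import Mathlib

section
/- If X and Y are cross-intersecting families of k-element subsets of [n] (every member of X intersects every member of Y), then |X|·|Y| ≤ C(n−1, k−1)^2. -/
namespace CrossInt

open Finset

variable {α : Type*} [DecidableEq α]

/-- average of `g` over the `l`-subsets of `S` -/
noncomputable def avg (S : Finset α) (l : ℕ) (g : Finset α → ℝ) : ℝ :=
  (∑ y ∈ S.powersetCard l, g y) / (S.card.choose l : ℝ)

/-- squared second singular value -/
noncomputable def rr (m k l : ℕ) : ℝ := (k * l : ℝ) / (((m : ℝ) - k) * ((m : ℝ) - l))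

lemma rr_comm (m k l : ℕ) : rr m k l = rr m l k := by
  unfold rr; rw [mul_comm (k : ℝ), mul_comm ((m : ℝ) - k)]

lemma rr_nonneg {m k l : ℕ} (h : k + l ≤ m) : 0 ≤ rr m k l := by
  have : (k : ℝ) + l ≤ m := by exact_mod_cast h
  have h1 : (0 : ℝ) ≤ k := Nat.cast_nonneg k
  have h2 : (0 : ℝ) ≤ l := Nat.cast_nonneg l
  unfold rr
  apply div_nonneg (by positivity)
  apply mul_nonneg <;> linarith

lemma rr_le_one {m k l : ℕ} (h : k + l ≤ m) : rr m k l ≤ 1 := by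
  have : (k : ℝ) + l ≤ m := by exact_mod_cast h
  have h1 : (0 : ℝ) ≤ k := Nat.cast_nonneg k
  have h2 : (0 : ℝ) ≤ l := Nat.cast_nonneg l
  unfold rr
  apply div_le_one_of_le₀
  · nlinarith
  · apply mul_nonneg <;> linarith

lemma avg_mono (S : Finset α) (l : ℕ) (g h : Finset α → ℝ)
    (H : ∀ y, y ⊆ S → y.card = l → g y ≤ h y) : avg S l g ≤ avg S l h := by
  unfold avg
  gcongr with y hy
  rw [mem_powersetCard] at hy
  exact H y hy.1 hy.2

lemma avg_congr (S : Finset α) (l : ℕ) (g h : Finset α → ℝ)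
    (H : ∀ y, y ⊆ S → y.card = l → g y = h y) : avg S l g = avg S l h :=
  le_antisymm (avg_mono S l g h fun y a b => (H y a b).le)
    (avg_mono S l h g fun y a b => (H y a b).ge)

lemma avg_add (S : Finset α) (l : ℕ) (g h : Finset α → ℝ) :
    avg S l (fun y => g y + h y) = avg S l g + avg S l h := by
  unfold avg; rw [sum_add_distrib, add_div]

lemma avg_smul (S : Finset α) (l : ℕ) (c : ℝ) (g : Finset α → ℝ) :
    avg S l (fun y => c * g y) = c * avg S l g := by
  unfold avg; rw [← mul_sum, mul_div_assoc]

lemma avg_const (S : Finset α) (l : ℕ) (h : l ≤ S.card) (c : ℝ) :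
    avg S l (fun _ => c) = c := by
  unfold avg
  have : (S.card.choose l : ℝ) ≠ 0 := by exact_mod_cast (Nat.choose_pos h).ne'
  rw [sum_const, card_powersetCard, nsmul_eq_mul]
  field_simp

lemma choose_swap (m k l : ℕ) (h : k + l ≤ m) :
    m.choose k * (m - k).choose l = m.choose l * (m - l).choose k := by
  obtain ⟨d, rfl⟩ := Nat.exists_eq_add_of_le h
  have e1 := Nat.choose_mul (n := k + l + d) (k := k + l) (s := k) (by omega) 
  have e2 := Nat.choose_mul (n := k + l + d) (k := k + l) (s := l) (by omega) 
  rw [show k + l - k = l by omega] at e1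
  rw [show k + l - l = k by omega] at e2
  rw [← e1, ← e2, Nat.choose_symm_add (a := k) (b := l)]

lemma avg_swap (S : Finset α) (k l : ℕ) (h : k + l ≤ S.card) (F : Finset α → Finset α → ℝ) :
    avg S k (fun x => avg (S \ x) l (fun y => F x y)) =
      avg S l (fun y => avg (S \ y) k (fun x => F x y)) := by
  have key : ∀ (k l : ℕ) (F : Finset α → Finset α → ℝ),
      avg S k (fun x => avg (S \ x) l (fun y => F x y)) =
      (∑ x ∈ S.powersetCard k, ∑ y ∈ (S \ x).powersetCard l, F x y) /
        ((S.card.choose k * (S.card - k).choose l : ℕ) : ℝ) := by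
    intro k l F
    unfold avg
    push_cast
    rw [mul_comm, ← div_div]
    congr 1
    rw [sum_div]
    apply sum_congr rfl
    intro x hx
    rw [mem_powersetCard] at hx
    rw [card_sdiff_of_subset hx.1, hx.2]
  rw [key, key l k (fun y x => F x y), choose_swap _ _ _ h]
  congr 1
  apply sum_comm'
  intro x y
  simp only [mem_powersetCard, subset_sdiff]
  constructor
  · rintro ⟨⟨a, b⟩, ⟨c, d⟩, e⟩
    exact ⟨⟨⟨a, d.symm⟩, b⟩, c, e⟩
  · rintro ⟨⟨⟨a, d⟩, b⟩, c, e⟩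
    exact ⟨⟨a, b⟩, ⟨c, d.symm⟩, e⟩

lemma avg_avg (S : Finset α) (k l : ℕ) (h : k + l ≤ S.card) (g : Finset α → ℝ) :
    avg S k (fun x => avg (S \ x) l g) = avg S l g := by
  rw [avg_swap S k l h (fun _ y => g y)]
  apply avg_congr
  intro y hy hl
  apply avg_const
  rw [card_sdiff_of_subset hy]; omega

lemma sum_insert_count (S : Finset α) (k : ℕ) (F : Finset α → ℝ) :
    ∑ i ∈ S, ∑ x ∈ (S.erase i).powersetCard k, F (insert i x) =
      (k + 1) * ∑ x ∈ S.powersetCard (k + 1), F x := by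
  have : ((k : ℝ) + 1) * ∑ x ∈ S.powersetCard (k + 1), F x =
      ∑ x ∈ S.powersetCard (k + 1), ∑ i ∈ x, F x := by
    rw [mul_sum]
    apply sum_congr rfl
    intro x hx
    rw [mem_powersetCard] at hx
    rw [sum_const, hx.2, nsmul_eq_mul]
    push_cast; ring
  rw [this, sum_sigma', sum_sigma']
  refine sum_bij' (fun p _ => ⟨insert p.1 p.2, p.1⟩) (fun p _ => ⟨p.2, p.1.erase p.2⟩) ?_ ?_ ?_ ?_ ?_
  · rintro ⟨i, x⟩ h
    simp only [mem_sigma, mem_powersetCard, subset_erase] at h ⊢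
    obtain ⟨hi, ⟨h1, h2⟩, h3⟩ := h
    refine ⟨⟨insert_subset hi h1, ?_⟩, mem_insert_self _ _⟩
    rw [card_insert_of_notMem h2, h3]
  · rintro ⟨x, i⟩ h
    simp only [mem_sigma, mem_powersetCard] at h ⊢
    obtain ⟨⟨h1, h2⟩, h3⟩ := h
    refine ⟨h1 h3, erase_subset_erase _ h1, ?_⟩
    rw [card_erase_of_mem h3, h2]; rfl
  · rintro ⟨i, x⟩ h
    simp only [mem_sigma, mem_powersetCard, subset_erase] at h ⊢
    rw [erase_insert h.2.1.2]
  · rintro ⟨x, i⟩ h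
    simp only [mem_sigma, mem_powersetCard] at h ⊢
    rw [insert_erase h.2]
  · rintro ⟨i, x⟩ h
    rfl

lemma avg_one (S : Finset α) (g : Finset α → ℝ) :
    avg S 1 g = (∑ i ∈ S, g {i}) / (S.card : ℝ) := by
  unfold avg
  rw [powersetCard_one, sum_map, Nat.choose_one_right]
  rfl

lemma avg_succ (S : Finset α) (k : ℕ) (h : k + 1 ≤ S.card) (F : Finset α → ℝ) :
    avg S (k + 1) F = avg S 1 (fun z => avg (S \ z) k (fun x => F (z ∪ x))) := by
  rw [avg_one]
  have e : ∀ i ∈ S, avg (S \ {i}) k (fun x => F ({i} ∪ x)) =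
      (∑ x ∈ (S.erase i).powersetCard k, F (insert i x)) / ((S.card - 1).choose k : ℝ) := by
    intro i hi
    unfold avg
    rw [sdiff_singleton_eq_erase, card_erase_of_mem hi]
    rfl
  rw [sum_congr rfl e, ← sum_div, sum_insert_count]
  unfold avg
  obtain ⟨m, hm⟩ : ∃ m, S.card = m + 1 := ⟨S.card - 1, by omega⟩
  rw [hm]
  have h1 : ((m + 1).choose (k + 1) : ℝ) ≠ 0 := by
    exact_mod_cast (Nat.choose_pos (by omega)).ne'
  have h2 : (m.choose k : ℝ) ≠ 0 := by
    exact_mod_cast (Nat.choose_pos (by omega)).ne'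
  have h3 : ((m : ℝ) + 1) * m.choose k = (m + 1).choose (k + 1) * (k + 1) := by
    exact_mod_cast Nat.add_one_mul_choose_eq m k
  have h4 : (m : ℝ) + 1 ≠ 0 := by positivity
  simp only [Nat.add_sub_cancel]
  push_cast
  rw [div_div, div_eq_div_iff h1 (mul_ne_zero h2 h4)]
  linear_combination (∑ x ∈ S.powersetCard (k + 1), F x) * h3

/-- The spectral inequality. -/
def Claim (S : Finset α) (k l : ℕ) : Prop := ∀ g : Finset α → ℝ,
  avg S k (fun x => (avg (S \ x) l g) ^ 2) ≤
    (1 - rr S.card k l) * (avg S l g) ^ 2 + rr S.card k l * avg S l (fun y => g y ^ 2)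

lemma claim_one_one (S : Finset α) (h : 2 ≤ S.card) : Claim S 1 1 := by
  intro g
  apply le_of_eq
  have h0 : (2 : ℝ) ≤ S.card := by exact_mod_cast h
  rw [avg_one S (fun x => (avg (S \ x) 1 g) ^ 2), avg_one, avg_one]
  have e : ∀ i ∈ S, (avg (S \ {i}) 1 g) ^ 2 =
      ((∑ j ∈ S, g {j}) ^ 2 - 2 * (∑ j ∈ S, g {j}) * g {i} + g {i} ^ 2)
        / ((S.card : ℝ) - 1) ^ 2 := by
    intro i hi
    rw [avg_one, sdiff_singleton_eq_erase, card_erase_of_mem hi, Nat.cast_sub (by omega),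
      ← add_sum_erase S (fun j => g {j}) hi, div_pow]
    push_cast
    congr 1
    ring
  rw [sum_congr rfl e, ← sum_div, sum_add_distrib, sum_sub_distrib, ← mul_sum, sum_const,
    nsmul_eq_mul]
  unfold rr
  have h1 : (S.card : ℝ) ≠ 0 := by linarith
  have h2 : (S.card : ℝ) - 1 ≠ 0 := by linarith
  push_cast
  field_simp
  ring

lemma claim_zero (S : Finset α) (l : ℕ) : Claim S 0 l := by
  intro g
  apply le_of_eq
  simp [avg, rr]

lemma rr_rec (m k l : ℕ) (hl : 1 ≤ l) (h : k + 1 + l ≤ m + 1) :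
    rr (m + 1) (k + 1) l = rr m k l + (1 - rr m k l) * rr (m + 1) 1 l := by
  have h0 : (k : ℝ) + 1 + l ≤ m + 1 := by exact_mod_cast h
  have h1 : (1 : ℝ) ≤ l := by exact_mod_cast hl
  have hk : (0 : ℝ) ≤ k := Nat.cast_nonneg k
  rcases Nat.eq_zero_or_pos k with rfl | hk'
  · simp [rr]
  have hk2 : (1 : ℝ) ≤ k := by exact_mod_cast hk'
  unfold rr
  push_cast
  have a1 : (m : ℝ) + 1 - (k + 1) ≠ 0 := by intro; linarith
  have a2 : (m : ℝ) + 1 - l ≠ 0 := by intro; linarith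
  have a3 : (m : ℝ) - k ≠ 0 := by intro; linarith
  have a4 : (m : ℝ) - l ≠ 0 := by intro; linarith
  have a5 : (m : ℝ) + 1 - 1 ≠ 0 := by intro; linarith
  have a6 : (m : ℝ) ≠ 0 := by intro; linarith
  rw [show (m : ℝ) + 1 - (k + 1) = m - k by ring, show (m : ℝ) + 1 - 1 = m by ring]
  field_simp
  ring

lemma claim_main (l : ℕ) (hl : 1 ≤ l)
    (h3 : ∀ S : Finset α, 1 + l ≤ S.card → Claim S 1 l) :
    ∀ (k : ℕ) (S : Finset α), k + l ≤ S.card → Claim S k l := by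
  intro k
  induction k with
  | zero => intro S _; exact claim_zero S l
  | succ k ih =>
    intro S hS g
    obtain ⟨m, hm⟩ : ∃ m, S.card = m + 1 := ⟨S.card - 1, by omega⟩
    rw [avg_succ S k (by omega)]
    have hz : ∀ z, z ⊆ S → z.card = 1 → (S \ z).card = m := by
      intro z hz hz1
      rw [card_sdiff_of_subset hz]; omega
    have step : avg S 1 (fun z => avg (S \ z) k (fun x => (avg (S \ (z ∪ x)) l g) ^ 2)) ≤
        avg S 1 (fun z => (1 - rr m k l) * (avg (S \ z) l g) ^ 2 +
          rr m k l * avg (S \ z) l (fun y => g y ^ 2)) := by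
      apply avg_mono
      intro z hzS hz1
      have := ih (S \ z) (by rw [hz z hzS hz1]; omega) g
      rw [hz z hzS hz1] at this
      simpa only [sdiff_sdiff_left, sup_eq_union] using this
    refine step.trans ?_
    rw [avg_add, avg_smul, avg_smul, avg_avg S 1 l (by omega)]
    have c := h3 S (by omega) g
    have r1 : 0 ≤ 1 - rr m k l := by
      have := rr_le_one (m := m) (k := k) (l := l) (by omega)
      linarith
    have c' := mul_le_mul_of_nonneg_left c r1
    rw [hm] at c' ⊢
    rw [rr_rec m k l hl (by omega)]
    nlinarith [c']

lemma avg_cauchy (S : Finset α) (l : ℕ) (f g : Finset α → ℝ) :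
    (avg S l (fun y => f y * g y)) ^ 2 ≤
      avg S l (fun y => f y ^ 2) * avg S l (fun y => g y ^ 2) := by
  unfold avg
  rw [div_pow, div_mul_div_comm, ← sq]
  gcongr
  exact sum_mul_sq_le_sq_mul_sq _ _ _

lemma avg_nonneg (S : Finset α) (l : ℕ) (f : Finset α → ℝ) (h : ∀ y, 0 ≤ f y) :
    0 ≤ avg S l f := by
  unfold avg
  have := sum_nonneg (s := S.powersetCard l) (f := f) fun y _ => h y
  positivity

lemma avg_var (S : Finset α) (l : ℕ) (h : l ≤ S.card) (f : Finset α → ℝ) (c : ℝ) :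
    avg S l (fun y => (f y - c) ^ 2) =
      avg S l (fun y => f y ^ 2) - 2 * c * avg S l f + c ^ 2 := by
  have : (fun y => (f y - c) ^ 2) = fun y => f y ^ 2 + ((-2 * c) * f y + c ^ 2) := by
    ext y; ring
  rw [this, avg_add, avg_add, avg_smul, avg_const S l h]
  ring

lemma claim_dual (S : Finset α) (k l : ℕ) (h : k + l ≤ S.card) (H : Claim S l k) :
    Claim S k l := by
  intro g
  set μ := avg S l g with hμ
  set T : Finset α → ℝ := fun x => avg (S \ x) l g with hT
  have hTμ : avg S k T = μ := avg_avg S k l h g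
  set c : Finset α → ℝ := fun x => T x - μ with hc
  have hc0 : avg S k c = 0 := by
    have : c = fun x => T x + (-μ) := by ext x; simp only [hc]; ring
    rw [this, avg_add, hTμ, avg_const S k (by omega)]; ring
  have hV : avg S k (fun x => c x ^ 2) = avg S k (fun x => T x ^ 2) - μ ^ 2 := by
    rw [avg_var S k (by omega), hTμ]; ring
  have hG : avg S l (fun y => (g y - μ) ^ 2) = avg S l (fun y => g y ^ 2) - μ ^ 2 := by
    rw [avg_var S l (by omega), ← hμ]; ring
  have e1 : avg S k (fun x => c x ^ 2) =
      avg S k (fun x => avg (S \ x) l (fun y => c x * (g y - μ))) := by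
    apply avg_congr
    intro x hx hxk
    have hcard : l ≤ (S \ x).card := by rw [card_sdiff_of_subset hx]; omega
    have : (fun y => g y - μ) = fun y => g y + (-μ) := by ext y; ring
    rw [avg_smul, this, avg_add, avg_const _ _ hcard]
    simp only [hc, hT]; ring
  have e2 : avg S k (fun x => c x ^ 2) =
      avg S l (fun y => (g y - μ) * avg (S \ y) k c) := by
    rw [e1, avg_swap S k l h (fun x y => c x * (g y - μ))]
    apply avg_congr
    intro y _ _
    rw [← avg_smul]
    congr 1; ext x; ring
  have e3 := avg_cauchy S l (fun y => g y - μ) (fun y => avg (S \ y) k c)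
  rw [← e2] at e3
  have e4 := H c
  rw [hc0, rr_comm] at e4
  set V := avg S k (fun x => c x ^ 2) with hVd
  set W := avg S l (fun y => (g y - μ) ^ 2) with hWd
  have hV0 : 0 ≤ V := avg_nonneg _ _ _ fun _ => sq_nonneg _
  have hW0 : 0 ≤ W := avg_nonneg _ _ _ fun _ => sq_nonneg _
  have r0 := rr_nonneg h
  have e5 : V ^ 2 ≤ W * (rr S.card k l * V) := by
    refine e3.trans (mul_le_mul_of_nonneg_left ?_ hW0)
    linarith
  have e6 : V ≤ rr S.card k l * W := by
    rcases hV0.eq_or_lt with h0 | h0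
    · rw [← h0]; positivity
    · nlinarith
  change avg S k (fun x => T x ^ 2) ≤ _
  rw [hG] at e6
  nlinarith

lemma claim_all (k l : ℕ) (hl : 1 ≤ l) (S : Finset α) (h : k + l ≤ S.card) : Claim S k l := by
  refine claim_main l hl ?_ k S h
  intro S hS
  apply claim_dual S 1 l hS
  exact claim_main 1 le_rfl (fun S hS => claim_one_one S hS) l S (by omega)

end CrossInt

open CrossInt in
/-- Cross-intersecting bound: if X and Y are cross-intersecting families of
k-element subsets of [n] (with n ≥ 2k), then |X|·|Y| ≤ C(n−1,k−1)². -/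
theorem stmt_4 (n k : ℕ) (hnk : 2 * k ≤ n)
    (X Y : Finset (Finset (Fin n)))
    (hX : ∀ x ∈ X, x.card = k) (hY : ∀ y ∈ Y, y.card = k)
    (hcross : ∀ x ∈ X, ∀ y ∈ Y, (x ∩ y).Nonempty) :
    X.card * Y.card ≤ ((n - 1).choose (k - 1)) ^ 2 := by
  rcases Finset.eq_empty_or_nonempty Y with rfl | ⟨y0, hy0⟩
  · simp
  rcases Finset.eq_empty_or_nonempty X with rfl | ⟨x0, hx0⟩
  · simp
  have hk : 1 ≤ k := by
    rw [← hX x0 hx0]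
    exact ((hcross x0 hx0 y0 hy0).mono Finset.inter_subset_left).card_pos
  set S : Finset (Fin n) := Finset.univ with hS
  have hSc : S.card = n := by simp [hS]
  set N : ℝ := (n.choose k : ℝ) with hN
  have hNpos : 0 < N := by
    rw [hN]; exact_mod_cast Nat.choose_pos (by omega)
  have hsub : ∀ Z : Finset (Finset (Fin n)), (∀ z ∈ Z, z.card = k) → 
      avg S k (fun z => if z ∈ Z then (1 : ℝ) else 0) = Z.card / N := by
    intro Z hZ
    unfold avg
    rw [hSc, Finset.sum_ite_mem, Finset.sum_const, nsmul_eq_mul, mul_one,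
      Finset.inter_eq_right.2]
    intro z hz
    simp [hS, hZ z hz]
  set a : ℝ := X.card / N with ha
  set b : ℝ := Y.card / N with hb
  set g : Finset (Fin n) → ℝ := fun z => if z ∈ Y then (1 : ℝ) else 0 with hg
  set f : Finset (Fin n) → ℝ := fun z => if z ∈ X then (1 : ℝ) else 0 with hf
  have hga : avg S k g = b := hsub Y hY
  have hfa : avg S k f = a := hsub X hX
  have hg2 : (fun y => g y ^ 2) = g := by
    ext y; simp only [hg]; split_ifs <;> simp
  have hf2 : (fun y => (1 - f y) ^ 2) = fun y => 1 + (-1) * f y := by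
    ext y; simp only [hf]; split_ifs <;> simp
  have hcl := claim_all k k hk S (by omega) g
  rw [hg2, hga, hSc] at hcl
  have hT : avg S k (fun x => avg (S \ x) k g) = b := by
    rw [avg_avg S k k (by omega), hga]
  have hT2 : avg S k (fun x => (1 - f x) * avg (S \ x) k g) = b := by
    rw [← hT]
    apply avg_congr
    intro x _ _
    by_cases hx : x ∈ X
    · have : avg (S \ x) k g = 0 := by
        unfold avg
        rw [Finset.sum_eq_zero, zero_div]
        intro y hy
        rw [Finset.mem_powersetCard, Finset.subset_sdiff] at hy
        simp only [hg]
        rw [if_neg]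
        intro hyY
        have := hcross x hx y hyY
        rw [Finset.disjoint_iff_inter_eq_empty.1 hy.1.2.symm] at this
        exact Finset.not_nonempty_empty this
      rw [this, mul_zero]
    · simp [hf, hx]
  have hcs := avg_cauchy S k (fun x => 1 - f x) (fun x => avg (S \ x) k g)
  rw [hT2, hf2, avg_add, avg_smul, hfa, avg_const S k (by omega)] at hcs
  have hle : ∀ Z : Finset (Finset (Fin n)), (∀ z ∈ Z, z.card = k) → (Z.card : ℝ) / N ≤ 1 := by
    intro Z hZ
    rw [← hsub Z hZ]
    refine le_of_le_of_eq ?_ (avg_const S k (by omega) 1)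
    apply avg_mono
    intro y _ _
    split_ifs <;> norm_num
  have ha1 : a ≤ 1 := hle X hX
  have hb1 : b ≤ 1 := hle Y hY
  have ha0 : 0 ≤ a := by positivity
  have hb0 : 0 < b := by
    have : 0 < Y.card := Finset.card_pos.2 ⟨y0, hy0⟩
    positivity
  have hkn : (2 : ℝ) * k ≤ n := by exact_mod_cast hnk
  have hk1 : (1 : ℝ) ≤ k := by exact_mod_cast hk
  set ρ : ℝ := k / (n - k) with hρ
  have hρ0 : 0 ≤ ρ := div_nonneg (by linarith) (by linarith)
  have hrr : rr n k k = ρ ^ 2 := by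
    unfold rr; rw [hρ, div_pow, sq, sq]
  rw [hrr] at hcl
  have m1 : b ^ 2 ≤ (1 - a) * ((1 - ρ ^ 2) * b ^ 2 + ρ ^ 2 * b) := by
    refine hcs.trans ?_
    have : 1 + -1 * a = 1 - a := by ring
    rw [this]
    exact mul_le_mul_of_nonneg_left hcl (by linarith)
  have m2 : b ≤ (1 - a) * ((1 - ρ ^ 2) * b + ρ ^ 2) := by
    apply le_of_mul_le_mul_left _ hb0
    linarith
  have m3 : a * b ≤ ρ ^ 2 * ((1 - a) * (1 - b)) := by nlinarith
  set s := Real.sqrt (a * b) with hs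
  have hs0 : 0 ≤ s := Real.sqrt_nonneg _
  have hss : s ^ 2 = a * b := Real.sq_sqrt (by positivity)
  have hs1 : s ≤ 1 := by
    rw [hs]; apply Real.sqrt_le_one.2; nlinarith
  have m4 : (1 - a) * (1 - b) ≤ (1 - s) ^ 2 := by
    have : 2 * s ≤ a + b := by
      apply le_of_sq_le_sq _ (by positivity)
      nlinarith [sq_nonneg (a - b)]
    nlinarith
  have m5 : s ≤ ρ * (1 - s) := by
    apply le_of_sq_le_sq _ (mul_nonneg hρ0 (by linarith))
    rw [hss, mul_pow]
    exact m3.trans (mul_le_mul_of_nonneg_left m4 (sq_nonneg _))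
  have m6 : s ≤ k / n := by
    have hd : (0 : ℝ) < n - k := by linarith
    rw [hρ, div_mul_eq_mul_div, le_div_iff₀ hd] at m5
    rw [le_div_iff₀ (by linarith)]
    linarith
  have m7 : a * b ≤ (k / n : ℝ) ^ 2 := by
    rw [← hss]; gcongr
  have hch : (k / n : ℝ) * N = ((n - 1).choose (k - 1) : ℕ) := by
    obtain ⟨m, rfl⟩ : ∃ m, n = m + 1 := ⟨n - 1, by omega⟩
    obtain ⟨j, rfl⟩ : ∃ j, k = j + 1 := ⟨k - 1, by omega⟩
    have h3 : ((m : ℝ) + 1) * m.choose j = (m + 1).choose (j + 1) * (j + 1) := by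
      exact_mod_cast Nat.add_one_mul_choose_eq m j
    rw [hN]
    simp only [Nat.add_sub_cancel]
    push_cast
    have h4 : (m : ℝ) + 1 ≠ 0 := by positivity
    field_simp
    linarith
  have fin : (X.card : ℝ) * Y.card ≤ (((n - 1).choose (k - 1) : ℕ) : ℝ) ^ 2 := by
    rw [← hch, mul_pow]
    have e : (X.card : ℝ) * Y.card = a * b * N ^ 2 := by
      rw [ha, hb]; field_simp
    rw [e]
    gcongr
  exact_mod_cast fin
end

section
/- In the Kneser graph K(n,k), for every vertex set S with |S| = r ≥ 1, the boundary B(S) = {a ∉ S : a is adjacent to some b ∈ S} satisfies |B(S)| ≥ C(n,k) − (1/r)·C(n−1,k−1)^2 − r. -/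
/-- Level j of the cube. -/
abbrev KLev (n j : ℕ) : Finset (Finset (Fin n)) := (Finset.univ : Finset (Fin n)).powersetCard j

/-- Up operator. -/
def KUp {n : ℕ} (g : Finset (Fin n) → ℝ) (z : Finset (Fin n)) : ℝ := ∑ x ∈ z, g (z.erase x)

/-- Down operator. -/
def KDn {n : ℕ} (g : Finset (Fin n) → ℝ) (z : Finset (Fin n)) : ℝ := ∑ x ∈ zᶜ, g (insert x z)

lemma kadj {n : ℕ} (j : ℕ) (g h : Finset (Fin n) → ℝ) :
    ∑ z ∈ KLev n (j+1), KUp g z * h z = ∑ y ∈ KLev n j, g y * KDn h y := by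
  simp only [KUp, KDn, Finset.sum_mul, Finset.mul_sum]
  rw [Finset.sum_sigma', Finset.sum_sigma']
  refine Finset.sum_bij' (fun p _ => ⟨p.1.erase p.2, p.2⟩) (fun p _ => ⟨insert p.2 p.1, p.2⟩) ?_ ?_ ?_ ?_ ?_
  · rintro ⟨z, x⟩ h
    simp only [Finset.mem_sigma, Finset.mem_powersetCard_univ] at h
    simp [Finset.card_erase_of_mem h.2, h.1]
  · rintro ⟨z, x⟩ h
    simp only [Finset.mem_sigma, Finset.mem_powersetCard_univ, Finset.mem_compl] at h
    simp [Finset.card_insert_of_notMem h.2, h.1]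
  · rintro ⟨z, x⟩ h
    simp only [Finset.mem_sigma] at h
    simp [Finset.insert_erase h.2]
  · rintro ⟨z, x⟩ h
    simp only [Finset.mem_sigma, Finset.mem_compl] at h
    simp [Finset.erase_insert h.2]
  · rintro ⟨z, x⟩ h
    simp only [Finset.mem_sigma] at h
    simp [Finset.insert_erase h.2]

lemma kcomm {n : ℕ} (g : Finset (Fin n) → ℝ) (z : Finset (Fin n)) :
    KDn (KUp g) z = KUp (KDn g) z + ((n : ℝ) - 2 * z.card) * g z := by
  have h1 : KDn (KUp g) z = ∑ x ∈ zᶜ, (g z + ∑ w ∈ z, g (insert x (z.erase w))) := by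
    unfold KDn KUp
    refine Finset.sum_congr rfl fun x hx => ?_
    rw [Finset.mem_compl] at hx
    rw [Finset.sum_insert hx, Finset.erase_insert hx]
    congr 1
    refine Finset.sum_congr rfl fun w hw => ?_
    rw [Finset.erase_insert_of_ne]
    rintro rfl; exact hx hw
  have h2 : KUp (KDn g) z = ∑ w ∈ z, (g z + ∑ x ∈ zᶜ, g (insert x (z.erase w))) := by
    unfold KDn KUp
    refine Finset.sum_congr rfl fun w hw => ?_
    beta_reduce
    rw [Finset.compl_erase, Finset.sum_insert (by simpa using hw), Finset.insert_erase hw]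
  rw [h1, h2, Finset.sum_add_distrib, Finset.sum_add_distrib, Finset.sum_comm]
  simp only [Finset.sum_const, nsmul_eq_mul, Finset.card_compl, Fintype.card_fin]
  rw [Nat.cast_sub (by simpa using Finset.card_le_univ z)]
  ring

lemma kmeanU {n : ℕ} (j : ℕ) (g : Finset (Fin n) → ℝ) :
    ∑ z ∈ KLev n (j+1), KUp g z = ((n : ℝ) - j) * ∑ y ∈ KLev n j, g y := by
  have := kadj j g (fun _ => 1)
  simp only [mul_one] at this
  rw [this, Finset.mul_sum]
  refine Finset.sum_congr rfl fun y hy => ?_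
  rw [Finset.mem_powersetCard_univ] at hy
  simp only [KDn, Finset.sum_const, nsmul_eq_mul, Finset.card_compl, Fintype.card_fin]
  rw [Nat.cast_sub (by simpa using Finset.card_le_univ y), hy]
  ring

lemma kmeanD {n : ℕ} (j : ℕ) (h : Finset (Fin n) → ℝ) :
    ∑ y ∈ KLev n j, KDn h y = ((j : ℝ) + 1) * ∑ z ∈ KLev n (j+1), h z := by
  have := kadj j (fun _ => 1) h
  simp only [one_mul] at this
  rw [← this, Finset.mul_sum]
  refine Finset.sum_congr rfl fun y hy => ?_
  rw [Finset.mem_powersetCard_univ] at hy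
  simp [KUp, hy]

lemma knorm {n : ℕ} (i : ℕ) (hi : i + 1 ≤ n) (g : Finset (Fin n) → ℝ)
    (hg : ∑ z ∈ KLev n i, g z = 0) :
    ∑ z ∈ KLev n (i+1), KUp g z ^ 2 ≤ ((i : ℝ) * (n - i - 1)) * ∑ z ∈ KLev n i, g z ^ 2 := by
  induction i generalizing g with
  | zero =>
    have h0 : g ∅ = 0 := by simpa [KLev] using hg
    have := kadj 0 g (KUp g)
    simp only [← pow_two] at this
    rw [this]
    simp [KLev, h0]
  | succ i ih =>
    have e1 := kadj (i+1) g (KUp g)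
    have e2 := kadj i (KDn g) g
    simp only [← pow_two] at e1 e2
    have e3 : ∑ y ∈ KLev n (i+1), g y * KDn (KUp g) y =
        ∑ y ∈ KLev n (i+1), KUp (KDn g) y * g y +
          ((n : ℝ) - 2 * (i + 1)) * ∑ y ∈ KLev n (i+1), g y ^ 2 := by
      rw [Finset.mul_sum, ← Finset.sum_add_distrib]
      refine Finset.sum_congr rfl fun y hy => ?_
      rw [Finset.mem_powersetCard_univ] at hy
      rw [kcomm, hy]; push_cast; ring
    have e4 := ih (by omega) (KDn g) (by rw [kmeanD, hg, mul_zero])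
    have e5 := Finset.sum_mul_sq_le_sq_mul_sq (KLev n (i+1)) (KUp (KDn g)) g
    rw [e2] at e5
    rw [e1, e3, e2]
    have hQ : 0 ≤ ∑ y ∈ KLev n i, KDn g y ^ 2 := Finset.sum_nonneg fun _ _ => sq_nonneg _
    have hP : 0 ≤ ∑ y ∈ KLev n (i+1), g y ^ 2 := Finset.sum_nonneg fun _ _ => sq_nonneg _
    have hc : 0 ≤ (i : ℝ) * (n - i - 1) := by
      have : ((i + 1 + 1 : ℕ) : ℝ) ≤ n := by exact_mod_cast hi
      push_cast at this
      exact mul_nonneg (by positivity) (by linarith)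
    generalize ∑ y ∈ KLev n i, KDn g y ^ 2 = Q at *
    generalize ∑ y ∈ KLev n (i+1), g y ^ 2 = P at *
    have key : Q ≤ (i : ℝ) * (n - i - 1) * P := by
      rcases hQ.eq_or_lt with h | h
      · rw [← h]; positivity
      · have := e5.trans (mul_le_mul_of_nonneg_right e4 hP)
        nlinarith
    push_cast
    nlinarith

/-- Sum over the k-subsets. -/
def KT {n : ℕ} (k : ℕ) (f : Finset (Fin n) → ℝ) (z : Finset (Fin n)) : ℝ :=
  ∑ y ∈ z.powersetCard k, f y

lemma kUT {n : ℕ} (k : ℕ) (f : Finset (Fin n) → ℝ) (z : Finset (Fin n)) :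
    KUp (KT k f) z = ((z.card : ℝ) - k) * KT k f z := by
  unfold KUp KT
  rw [Finset.mul_sum, Finset.sum_comm' (t' := z.powersetCard k) (s' := fun y => z \ y)]
  · refine Finset.sum_congr rfl fun y hy => ?_
    rw [Finset.mem_powersetCard] at hy
    rw [Finset.sum_const, nsmul_eq_mul, Finset.card_sdiff_of_subset hy.1,
      Nat.cast_sub (Finset.card_le_card hy.1), hy.2]
  · intro x y
    simp only [Finset.mem_powersetCard, Finset.mem_sdiff, Finset.subset_erase]
    tauto

lemma kTnorm {n k : ℕ} (f : Finset (Fin n) → ℝ) (hf : ∑ z ∈ KLev n k, f z = 0) (m : ℕ)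
    (hm : k + m ≤ n) :
    ∑ z ∈ KLev n (k+m), KT k f z = 0 ∧
    (m.factorial : ℝ)^2 * ∑ z ∈ KLev n (k+m), KT k f z ^ 2 ≤
      (∏ i ∈ Finset.range m, (((k : ℝ) + i) * (n - (k + i) - 1))) * ∑ z ∈ KLev n k, f z ^ 2 := by
  induction m with
  | zero =>
    have : ∀ z ∈ KLev n k, KT k f z = f z := by
      intro z hz
      rw [Finset.mem_powersetCard_univ] at hz
      subst hz
      simp [KT]
    constructor
    · rw [← hf]; exact Finset.sum_congr rfl this
    · simp only [Nat.factorial_zero, Nat.cast_one, one_pow, one_mul, Finset.range_zero, Finset.prod_empty, add_zero]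
      exact (Finset.sum_congr rfl fun z hz => by rw [this z hz]).le
  | succ m ih =>
    obtain ⟨h1, h2⟩ := ih (by omega)
    have hu : ∀ z ∈ KLev n (k+m+1), KUp (KT k f) z = ((m : ℝ) + 1) * KT k f z := by
      intro z hz
      rw [Finset.mem_powersetCard_univ] at hz
      rw [kUT, hz]; push_cast; ring
    constructor
    · have := kmeanU (k+m) (KT k f)
      rw [h1, mul_zero, Finset.sum_congr rfl hu, ← Finset.mul_sum] at this
      exact (mul_eq_zero.1 this).resolve_left (by positivity)
    · have := knorm (k+m) (by omega) (KT k f) h1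
      rw [Finset.sum_congr rfl (fun z hz => by rw [hu z hz, mul_pow]), ← Finset.mul_sum] at this
      rw [Finset.prod_range_succ, Nat.factorial_succ]
      have hc : 0 ≤ ((k : ℝ) + m) * (n - (k + m) - 1) := by
        have : ((k + (m + 1) : ℕ) : ℝ) ≤ n := by exact_mod_cast hm
        push_cast at this
        exact mul_nonneg (by positivity) (by linarith)
      push_cast at this ⊢
      have a := mul_le_mul_of_nonneg_left this (sq_nonneg (m.factorial : ℝ))
      have b := mul_le_mul_of_nonneg_left h2 hc
      rw [← add_assoc]
      calc _ = _ := by ring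
        _ ≤ _ := a
        _ = _ := by ring
        _ ≤ _ := b
        _ = _ := by ring

lemma kprod {n k : ℕ} (hk : 1 ≤ k) (hnk : 2 * k ≤ n) :
    ∏ i ∈ Finset.range (n - 2*k), (((k : ℝ) + i) * (n - (k + i) - 1)) =
      ((n - 2*k).factorial : ℝ)^2 * ((n-k-1).choose (k-1) : ℝ)^2 := by
  obtain ⟨m, rfl⟩ := Nat.exists_eq_add_of_le hnk
  obtain ⟨k, rfl⟩ := Nat.exists_eq_add_of_le' hk
  have e1 : 2 * (k+1) + m - 2*(k+1) = m := by omega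
  have e2 : 2 * (k+1) + m - (k+1) - 1 = k + m := by omega
  have hs : (k+m).choose k = (k+m).choose m := by
    rw [Nat.choose_symm_add]
  rw [e1, e2, Finset.prod_mul_distrib, Nat.add_sub_cancel, hs]
  have h1 : ∏ i ∈ Finset.range m, (((k+1 : ℕ) : ℝ) + i) = m.factorial * (k+m).choose m := by
    have := Nat.ascFactorial_eq_factorial_mul_choose k m
    rw [Nat.ascFactorial_eq_prod_range] at this
    exact_mod_cast this
  have h2 : ∏ i ∈ Finset.range m, (((2 * (k+1) + m : ℕ) : ℝ) - (((k+1 : ℕ) : ℝ) + i) - 1) =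
      ∏ i ∈ Finset.range m, (((k+1 : ℕ) : ℝ) + i) := by
    rw [← Finset.prod_range_reflect]
    refine Finset.prod_congr rfl fun i hi => ?_
    rw [Finset.mem_range] at hi
    rw [Nat.sub_sub, Nat.cast_sub (by omega)]
    push_cast; ring
  rw [h2, h1]; ring

lemma karith (N a b d l M k n : ℝ) (hN0 : 0 < N) (hl0 : 0 < l) (hk0 : 0 < k) (hn0 : 0 < n)
    (ha0 : 0 ≤ a) (hb0 : 0 ≤ b) (hXN : a ≤ N) (hYN : b ≤ N) (hM0 : 0 ≤ M)
    (hdl : k * d = (n - k) * l) (hNM : k * N = n * M)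
    (hfin : (- a * d * N * b)^2 ≤ l^2 * (N * a * (N - a)) * (N * b * (N - b))) :
    a * b ≤ M^2 := by
  rcases (mul_nonneg ha0 hb0).eq_or_lt with h0 | h0
  · rw [← h0]; positivity
  obtain ⟨s, hs0, hs⟩ : ∃ s : ℝ, 0 < s ∧ s^2 = a * b :=
    ⟨√(a*b), Real.sqrt_pos.2 h0, Real.sq_sqrt h0.le⟩
  have hsN : s ≤ N := by
    apply (abs_le_of_sq_le_sq' _ hN0.le).2
    nlinarith [mul_le_mul hXN hYN hb0 hN0.le]
  have h1 : d^2 * (a*b) ≤ l^2 * ((N-a)*(N-b)) := by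
    have : (N^2 * (a*b)) * (d^2 * (a*b)) ≤ (N^2 * (a*b)) * (l^2 * ((N-a)*(N-b))) := by
      linarith [hfin]
    exact le_of_mul_le_mul_left this (by positivity)
  have h2 : (N-a)*(N-b) ≤ (N-s)^2 := by
    have : 2 * s ≤ a + b := by
      apply abs_le_of_sq_le_sq' _ (by positivity) |>.2
      nlinarith [sq_nonneg (a-b)]
    nlinarith
  have h3 : d * s ≤ l * (N - s) := by
    apply abs_le_of_sq_le_sq' _ (mul_nonneg hl0.le (by linarith)) |>.2
    have := mul_le_mul_of_nonneg_left h2 (sq_nonneg l)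
    nlinarith
  have h4 : s ≤ M := by
    have h5 : l * (n * s) ≤ l * (n * M) := by
      have := mul_le_mul_of_nonneg_left h3 hk0.le
      rw [← hNM]
      have e : k * (d * s) = (n - k) * l * s := by rw [← hdl]; ring
      rw [e] at this
      linarith
    exact le_of_mul_le_mul_left (le_of_mul_le_mul_left h5 hl0) hn0
  rw [← hs]
  exact pow_le_pow_left₀ hs0.le h4 2


lemma kcross {n k : ℕ} (hk : 1 ≤ k) (hnk : 2 * k ≤ n) (X Y : Finset (Finset (Fin n)))
    (hX : X ⊆ KLev n k) (hY : Y ⊆ KLev n k) (hXY : ∀ x ∈ X, ∀ y ∈ Y, ¬ Disjoint x y) :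
    (X.card : ℝ) * Y.card ≤ ((n-1).choose (k-1) : ℝ)^2 := by
  have hNc : (KLev n k).card = n.choose k := by simp [KLev]
  have hXN : (X.card : ℝ) ≤ n.choose k := by
    rw [← hNc]; exact_mod_cast Finset.card_le_card hX
  have hYN : (Y.card : ℝ) ≤ n.choose k := by
    rw [← hNc]; exact_mod_cast Finset.card_le_card hY
  have hN0 : (0 : ℝ) < n.choose k := by exact_mod_cast Nat.choose_pos (by omega)
  have hl0 : (0 : ℝ) < (n-k-1).choose (k-1) := by exact_mod_cast Nat.choose_pos (by omega)
  have hdl : (k : ℝ) * (n-k).choose k = (n - k) * (n-k-1).choose (k-1) := by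
    have := Nat.add_one_mul_choose_eq (n-k-1) (k-1)
    rw [show n-k-1+1 = n-k by omega, show k-1+1 = k by omega] at this
    rw [← Nat.cast_sub (by omega)]
    have h2 : ((n-k : ℕ) : ℝ) * (n-k-1).choose (k-1) = (n-k).choose k * k := by exact_mod_cast this
    rw [h2]; ring
  have hNM : (k : ℝ) * n.choose k = n * (n-1).choose (k-1) := by
    have := Nat.add_one_mul_choose_eq (n-1) (k-1)
    rw [show n-1+1 = n by omega, show k-1+1 = k by omega] at this
    have h2 : (n : ℝ) * (n-1).choose (k-1) = n.choose k * k := by exact_mod_cast this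
    rw [h2]; ring
  have hsum : ∀ Z ⊆ KLev n k, ∀ c : ℝ, ∑ z ∈ KLev n k, (if z ∈ Z then c else 0) = c * Z.card := by
    intro Z hZ c
    rw [Finset.sum_ite_mem, Finset.inter_eq_right.2 hZ]
    simp [mul_comm]
  set N : ℝ := (n.choose k : ℝ) with hN
  set a : ℝ := (X.card : ℝ) with ha
  set b : ℝ := (Y.card : ℝ) with hb
  have hmean : ∀ Z ⊆ KLev n k,
      ∑ z ∈ KLev n k, ((if z ∈ Z then N else 0) - (Z.card : ℝ)) = 0 := by
    intro Z hZ
    rw [Finset.sum_sub_distrib, hsum Z hZ, Finset.sum_const, hNc, nsmul_eq_mul]; ring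
  have hnorm : ∀ Z ⊆ KLev n k,
      ∑ z ∈ KLev n k, ((if z ∈ Z then N else 0) - (Z.card : ℝ))^2 = N * Z.card * (N - Z.card) := by
    intro Z hZ
    have : ∀ z, ((if z ∈ Z then N else 0) - (Z.card : ℝ))^2 =
        (if z ∈ Z then N^2 - 2 * N * Z.card else 0) + (Z.card : ℝ)^2 := by
      intro z; split_ifs <;> ring
    simp only [this]
    rw [Finset.sum_add_distrib, hsum Z hZ, Finset.sum_const, hNc, nsmul_eq_mul]; ring
  set f : Finset (Fin n) → ℝ := fun z => (if z ∈ X then N else 0) - a with hfdef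
  set g : Finset (Fin n) → ℝ := fun z => (if z ∈ Y then N else 0) - b with hgdef
  obtain ⟨t1, t2⟩ := kTnorm f (hmean X hX) (n - 2*k) (by omega)
  rw [kprod hk hnk, hnorm X hX, show k + (n - 2*k) = n - k by omega, mul_assoc] at t2
  rw [show k + (n - 2*k) = n - k by omega] at t1
  have t3 := le_of_mul_le_mul_left t2 (by positivity)
  have hre : ∀ F : Finset (Fin n) → ℝ, ∑ z ∈ KLev n (n-k), F z = ∑ y ∈ KLev n k, F yᶜ := by
    intro F
    refine Finset.sum_bij' (fun z _ => zᶜ) (fun z _ => zᶜ) ?_ ?_ ?_ ?_ ?_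
    · intro z hz
      rw [Finset.mem_powersetCard_univ] at hz ⊢
      rw [Finset.card_compl, Fintype.card_fin]; omega
    · intro z hz
      rw [Finset.mem_powersetCard_univ] at hz ⊢
      rw [Finset.card_compl, Fintype.card_fin]; omega
    · simp
    · simp
    · simp
  rw [hre] at t1 t3
  have hval : ∀ y ∈ Y, KT k f yᶜ = - a * (n-k).choose k := by
    intro y hy
    have hyc := hY hy
    rw [Finset.mem_powersetCard_univ] at hyc
    have : ∀ x ∈ yᶜ.powersetCard k, f x = - a := by
      intro x hx
      rw [Finset.mem_powersetCard] at hx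
      have : x ∉ X := fun h => hXY x h y hy (by
        rw [Finset.disjoint_left]; intro u hu; simpa using hx.1 hu)
      simp [hfdef, this]
    unfold KT
    rw [Finset.sum_congr rfl this, Finset.sum_const, Finset.card_powersetCard, Finset.card_compl,
      Fintype.card_fin, hyc, nsmul_eq_mul]; ring
  have hinner : ∑ y ∈ KLev n k, KT k f yᶜ * g y = - a * (n-k).choose k * N * b := by
    have : ∀ y ∈ KLev n k, KT k f yᶜ * g y =
        (if y ∈ Y then - a * (n-k).choose k * N else 0) - b * KT k f yᶜ := by
      intro y _
      by_cases h : y ∈ Y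
      · simp only [hgdef, h, if_true, hval y h]; ring
      · simp only [hgdef, h, if_false]; ring
    rw [Finset.sum_congr rfl this, Finset.sum_sub_distrib, ← Finset.mul_sum, t1, hsum Y hY]; ring
  have hcs := Finset.sum_mul_sq_le_sq_mul_sq (KLev n k) (fun y => KT k f yᶜ) g
  rw [hinner, hnorm Y hY] at hcs
  have hb0 : 0 ≤ b := by positivity
  have ha0 : 0 ≤ a := by positivity
  have hfin := hcs.trans (mul_le_mul_of_nonneg_right t3
    (mul_nonneg (mul_nonneg hN0.le hb0) (by linarith)))
  exact karith N a b _ _ _ k n hN0 hl0 (by exact_mod_cast hk)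
    (by exact_mod_cast (by omega : 0 < n)) ha0 hb0 hXN hYN (Nat.cast_nonneg _) hdl hNM hfin

/-- Boundary bound in the Kneser graph K(n,k): for any set S of r ≥ 1 vertices
(size-k subsets of [n]), the boundary B(S) = vertices outside S adjacent
(i.e. disjoint) to some member of S satisfies
|B(S)| ≥ C(n,k) − (1/r)·C(n−1,k−1)² − r. -/
theorem stmt_5 (n k r : ℕ) (hnk : 2 * k ≤ n) (hr : 1 ≤ r)
    (S : Finset (Finset (Fin n)))
    (hS : ∀ s ∈ S, s.card = k) (hcard : S.card = r) :
    ((n.choose k : ℝ) - (1 / (r : ℝ)) * (((n - 1).choose (k - 1) : ℝ)) ^ 2 - (r : ℝ)) ≤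
      ((((Finset.univ : Finset (Fin n)).powersetCard k).filter
        (fun a => a ∉ S ∧ ∃ b ∈ S, Disjoint a b)).card : ℝ) := by
  rcases Nat.eq_zero_or_pos k with rfl | hk
  · have h1 : (1 : ℝ) ≤ r := by exact_mod_cast hr
    refine le_trans ?_ (Nat.cast_nonneg _)
    have : 0 ≤ (1 / (r : ℝ)) * (((n - 1).choose (0 - 1) : ℝ)) ^ 2 := by positivity
    simp only [Nat.choose_zero_right, Nat.cast_one] at this ⊢
    linarith
  have hX : S ⊆ KLev n k := fun s hs => by
    rw [Finset.mem_powersetCard_univ]; exact hS s hs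
  set B := ((Finset.univ : Finset (Fin n)).powersetCard k).filter
        (fun a => a ∉ S ∧ ∃ b ∈ S, Disjoint a b) with hB
  set Y := (KLev n k \ S) \ B with hYdef
  have hBs : B ⊆ KLev n k \ S := by
    intro a ha
    rw [hB, Finset.mem_filter] at ha
    exact Finset.mem_sdiff.2 ⟨ha.1, ha.2.1⟩
  have hc1 := Finset.card_sdiff_add_card_eq_card hBs
  have hc2 := Finset.card_sdiff_add_card_eq_card hX
  have hNc : (KLev n k).card = n.choose k := by simp [KLev]
  have hY : Y ⊆ KLev n k := Finset.sdiff_subset.trans Finset.sdiff_subset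
  have hx := kcross hk hnk S Y hX hY (by
    intro x hx y hy hd
    rw [hYdef, Finset.mem_sdiff, Finset.mem_sdiff] at hy
    exact hy.2 (Finset.mem_filter.2 ⟨hy.1.1, hy.1.2, x, hx, hd.symm⟩))
  rw [hcard] at hx
  have htot : (n.choose k : ℝ) = Y.card + B.card + r := by
    rw [← hNc, ← hc2, ← hc1, hcard]; push_cast; rfl
  have hr0 : (0 : ℝ) < r := by exact_mod_cast hr
  have : (Y.card : ℝ) ≤ (1 / (r : ℝ)) * (((n - 1).choose (k - 1) : ℝ)) ^ 2 := by
    rw [one_div, inv_mul_eq_div, le_div_iff₀ hr0]; linarith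
  linarith
end
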